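/- arXiv:2006.03483 — 3 statements merged into one kernel-verified Lean document; each statement's English description precedes it below -/
import Mathlib

section
/- Let A : ℝⁿ →ₗ ℝⁿ and B : ℝᵐ →ₗ ℝⁿ be continuous linear maps, let u_j : ℝⁿ → ℝᵐ for j = 0, …, T−1 be Lipschitz continuous with a common constant K̄ ≥ 0, let ℓ_j : ℝⁿ × ℝᵐ → ℝ satisfy |ℓ_j(x,u) − ℓ_j(x',u')| ≤ L_{ℓ,j}·(‖x − x'‖ + ‖u − u'‖), and let ε_0, …, ε_{T−2} be integrable ℝⁿ-valued random variables on a probability space (Ω, μ). For each ω ∈ Ω define the closed-loop trajectory X_0(x,ω) = x, X_{j+1}(x,ω) = A X_j(x,ω) + B (u_j(X_j(x,ω))) + ε_j(ω), and assume that ω ↦ ℓ_j(X_j(x,ω), u_j(X_j(x,ω))) is integrable for every x and j. Then the expected future reward V(x) = E[ Σ_{j=0}^{T−1} ℓ_j(X_j(x,·), u_j(X_j(x,·))) ] is Lipschitz continuous with constant L_V = Σ_{j=0}^{T−1} L_{ℓ,j}·(‖A‖ + ‖B‖·K̄)^j·(1 + K̄). -/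
open MeasureTheory

/-- Two runs of a closed loop `z ↦ A z + B (u j z) + w j` driven by the same disturbance `w`
separate at most geometrically, with rate `‖A‖ + ‖B‖ * K`. -/
theorem norm_closedLoop_sub_le {E F : Type*} [NormedAddCommGroup E] [NormedSpace ℝ E]
    [NormedAddCommGroup F] [NormedSpace ℝ F] (A : E →L[ℝ] E) (B : F →L[ℝ] E)
    {u : ℕ → E → F} {K : ℝ} (hK : 0 ≤ K) (hu : ∀ j x y, ‖u j x - u j y‖ ≤ K * ‖x - y‖)
    {w X Y : ℕ → E} (hX : ∀ j, X (j + 1) = A (X j) + B (u j (X j)) + w j)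
    (hY : ∀ j, Y (j + 1) = A (Y j) + B (u j (Y j)) + w j) (j : ℕ) :
    ‖X j - Y j‖ ≤ (‖A‖ + ‖B‖ * K) ^ j * ‖X 0 - Y 0‖ := by
  induction j with
  | zero => simp
  | succ j ih =>
    calc ‖X (j + 1) - Y (j + 1)‖
        = ‖A (X j - Y j) + B (u j (X j) - u j (Y j))‖ := by
          rw [hX, hY, map_sub, map_sub]; congr 1; abel
      _ ≤ ‖A‖ * ‖X j - Y j‖ + ‖B‖ * ‖u j (X j) - u j (Y j)‖ :=
          norm_add_le_of_le (A.le_opNorm _) (B.le_opNorm _)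
      _ ≤ ‖A‖ * ‖X j - Y j‖ + ‖B‖ * (K * ‖X j - Y j‖) := by gcongr; exact hu j _ _
      _ = (‖A‖ + ‖B‖ * K) * ‖X j - Y j‖ := by ring
      _ ≤ (‖A‖ + ‖B‖ * K) * ((‖A‖ + ‖B‖ * K) ^ j * ‖X 0 - Y 0‖) := by gcongr
      _ = (‖A‖ + ‖B‖ * K) ^ (j + 1) * ‖X 0 - Y 0‖ := by ring

/-- For linear mean transitions with additive integrable noise, `K̄`-Lipschitz
feedback policies and Lipschitz stage rewards, the expected future reward
`V x = E[Σ_{j<T} ℓ j (X j x ·) (u j (X j x ·))]` is Lipschitz with constant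
`Σ_{j<T} L_{ℓ,j}·(‖A‖ + ‖B‖·K̄)^j·(1 + K̄)`. -/
theorem stmt_6 {n m : ℕ} (T : ℕ)
    {Ω : Type*} [MeasurableSpace Ω] (μ : Measure Ω) [IsProbabilityMeasure μ]
    (A : EuclideanSpace ℝ (Fin n) →L[ℝ] EuclideanSpace ℝ (Fin n))
    (B : EuclideanSpace ℝ (Fin m) →L[ℝ] EuclideanSpace ℝ (Fin n))
    (u : ℕ → EuclideanSpace ℝ (Fin n) → EuclideanSpace ℝ (Fin m))
    (K : ℝ) (hK : 0 ≤ K)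
    (hu : ∀ j x y, ‖u j x - u j y‖ ≤ K * ‖x - y‖)
    (ℓ : ℕ → EuclideanSpace ℝ (Fin n) → EuclideanSpace ℝ (Fin m) → ℝ)
    (Lℓ : ℕ → ℝ) (hLℓ : ∀ j, 0 ≤ Lℓ j)
    (hℓ : ∀ j x x' v v', |ℓ j x v - ℓ j x' v'| ≤ Lℓ j * (‖x - x'‖ + ‖v - v'‖))
    (ε : ℕ → Ω → EuclideanSpace ℝ (Fin n))
    (hε : ∀ j, Integrable (ε j) μ)
    (X : ℕ → EuclideanSpace ℝ (Fin n) → Ω → EuclideanSpace ℝ (Fin n))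
    (hX0 : ∀ x ω, X 0 x ω = x)
    (hXsucc : ∀ j x ω, X (j + 1) x ω = A (X j x ω) + B (u j (X j x ω)) + ε j ω)
    (hInt : ∀ j x, Integrable (fun ω => ℓ j (X j x ω) (u j (X j x ω))) μ) :
    ∀ x y,
      |(∫ ω, ∑ j ∈ Finset.range T, ℓ j (X j x ω) (u j (X j x ω)) ∂μ) -
        ∫ ω, ∑ j ∈ Finset.range T, ℓ j (X j y ω) (u j (X j y ω)) ∂μ| ≤
      (∑ j ∈ Finset.range T, Lℓ j * (‖A‖ + ‖B‖ * K) ^ j * (1 + K)) * ‖x - y‖ := by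
  intro x y
  have hreward (j : ℕ) (ω : Ω) :
      |ℓ j (X j x ω) (u j (X j x ω)) - ℓ j (X j y ω) (u j (X j y ω))| ≤
        Lℓ j * (‖A‖ + ‖B‖ * K) ^ j * (1 + K) * ‖x - y‖ := by
    have hstate : ‖X j x ω - X j y ω‖ ≤ (‖A‖ + ‖B‖ * K) ^ j * ‖x - y‖ := by
      simpa only [hX0] using norm_closedLoop_sub_le A B hK hu (w := fun j => ε j ω)
        (X := fun j => X j x ω) (Y := fun j => X j y ω)
        (fun j => hXsucc j x ω) (fun j => hXsucc j y ω) j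
    calc _ ≤ Lℓ j * (‖X j x ω - X j y ω‖ + ‖u j (X j x ω) - u j (X j y ω)‖) := hℓ _ _ _ _ _
      _ ≤ Lℓ j * (‖X j x ω - X j y ω‖ + K * ‖X j x ω - X j y ω‖) := by
          gcongr
          exacts [hLℓ j, hu j _ _]
      _ = Lℓ j * (1 + K) * ‖X j x ω - X j y ω‖ := by ring
      _ ≤ Lℓ j * (1 + K) * ((‖A‖ + ‖B‖ * K) ^ j * ‖x - y‖) :=
          mul_le_mul_of_nonneg_left hstate (mul_nonneg (hLℓ j) (by positivity))
      _ = _ := by ring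
  rw [← integral_sub (integrable_finsetSum _ fun j _ => hInt j x)
    (integrable_finsetSum _ fun j _ => hInt j y), ← Real.norm_eq_abs]
  refine (norm_integral_le_of_norm_le_const (.of_forall fun ω => ?_)).trans_eq
    (by rw [probReal_univ, mul_one])
  rw [← Finset.sum_sub_distrib, Finset.sum_mul]
  exact norm_sum_le_of_le _ fun j _ => hreward j ω
end

section
/- Let f : ℝⁿ × ℝᵐ → ℝⁿ satisfy ‖f(x,u) − f(x',u')‖ ≤ L_fx·‖x − x'‖ + L_fu·‖u − u'‖, let u_j : ℝⁿ → ℝᵐ for j = 0, …, T−1 be Lipschitz continuous with a common constant K̄ ≥ 0, let ℓ_j : ℝⁿ × ℝᵐ → ℝ satisfy |ℓ_j(x,u) − ℓ_j(x',u')| ≤ L_{ℓ,j}·(‖x − x'‖ + ‖u − u'‖), and let ε_0, …, ε_{T−2} be integrable ℝⁿ-valued random variables on a probability space (Ω, μ). For each ω ∈ Ω define the closed-loop trajectory X_0(x,ω) = x, X_{j+1}(x,ω) = f(X_j(x,ω), u_j(X_j(x,ω))) + ε_j(ω), and assume that ω ↦ ℓ_j(X_j(x,ω), u_j(X_j(x,ω)))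 is integrable for every x and j. Then the expected future reward V(x) = E[ Σ_{j=0}^{T−1} ℓ_j(X_j(x,·), u_j(X_j(x,·))) ] is Lipschitz continuous with constant Σ_{j=0}^{T−1} L_{ℓ,j}·(L_fx + L_fu·K̄)^j·(1 + K̄). -/
open MeasureTheory

/-- For Lipschitz nonlinear mean transitions with additive integrable noise,
`K̄`-Lipschitz feedback policies and Lipschitz stage rewards, the expected future reward
`V x = E[Σ_{j<T} ℓ j (X j x ·) (u j (X j x ·))]` is Lipschitz with constant
`Σ_{j<T} L_{ℓ,j}·(L_fx + L_fu·K̄)^j·(1 + K̄)`. -/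
theorem stmt_7 {n m : ℕ} (T : ℕ)
    {Ω : Type*} [MeasurableSpace Ω] (μ : Measure Ω) [IsProbabilityMeasure μ]
    (f : EuclideanSpace ℝ (Fin n) → EuclideanSpace ℝ (Fin m) → EuclideanSpace ℝ (Fin n))
    (Lfx Lfu : ℝ) (hLfx : 0 ≤ Lfx) (hLfu : 0 ≤ Lfu)
    (hf : ∀ x x' v v', ‖f x v - f x' v'‖ ≤ Lfx * ‖x - x'‖ + Lfu * ‖v - v'‖)
    (u : ℕ → EuclideanSpace ℝ (Fin n) → EuclideanSpace ℝ (Fin m))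
    (K : ℝ) (hK : 0 ≤ K)
    (hu : ∀ j x y, ‖u j x - u j y‖ ≤ K * ‖x - y‖)
    (ℓ : ℕ → EuclideanSpace ℝ (Fin n) → EuclideanSpace ℝ (Fin m) → ℝ)
    (Lℓ : ℕ → ℝ) (hLℓ : ∀ j, 0 ≤ Lℓ j)
    (hℓ : ∀ j x x' v v', |ℓ j x v - ℓ j x' v'| ≤ Lℓ j * (‖x - x'‖ + ‖v - v'‖))
    (ε : ℕ → Ω → EuclideanSpace ℝ (Fin n))
    (hε : ∀ j, Integrable (ε j) μ)
    (X : ℕ → EuclideanSpace ℝ (Fin n) → Ω → EuclideanSpace ℝ (Fin n))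
    (hX0 : ∀ x ω, X 0 x ω = x)
    (hXsucc : ∀ j x ω, X (j + 1) x ω = f (X j x ω) (u j (X j x ω)) + ε j ω)
    (hInt : ∀ j x, Integrable (fun ω => ℓ j (X j x ω) (u j (X j x ω))) μ) :
    ∀ x y,
      |(∫ ω, ∑ j ∈ Finset.range T, ℓ j (X j x ω) (u j (X j x ω)) ∂μ) -
        ∫ ω, ∑ j ∈ Finset.range T, ℓ j (X j y ω) (u j (X j y ω)) ∂μ| ≤
      (∑ j ∈ Finset.range T, Lℓ j * (Lfx + Lfu * K) ^ j * (1 + K)) * ‖x - y‖ := by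
  intro x y
  have hρ : 0 ≤ Lfx + Lfu * K := by positivity
  have hX : ∀ j ω, ‖X j x ω - X j y ω‖ ≤ (Lfx + Lfu * K) ^ j * ‖x - y‖ := by
    intro j ω
    induction j with
    | zero => simp [hX0]
    | succ j ih =>
      rw [hXsucc, hXsucc, add_sub_add_right_eq_sub]
      calc ‖f (X j x ω) (u j (X j x ω)) - f (X j y ω) (u j (X j y ω))‖
          ≤ Lfx * ‖X j x ω - X j y ω‖ + Lfu * ‖u j (X j x ω) - u j (X j y ω)‖ := hf _ _ _ _
        _ ≤ Lfx * ‖X j x ω - X j y ω‖ + Lfu * (K * ‖X j x ω - X j y ω‖) := by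
          gcongr
          exact hu _ _ _
        _ = (Lfx + Lfu * K) * ‖X j x ω - X j y ω‖ := by ring
        _ ≤ (Lfx + Lfu * K) * ((Lfx + Lfu * K) ^ j * ‖x - y‖) := by gcongr
        _ = (Lfx + Lfu * K) ^ (j + 1) * ‖x - y‖ := by ring
  have hstage : ∀ j ω, |ℓ j (X j x ω) (u j (X j x ω)) - ℓ j (X j y ω) (u j (X j y ω))| ≤
      Lℓ j * (Lfx + Lfu * K) ^ j * (1 + K) * ‖x - y‖ := by
    intro j ω
    have hLj := hLℓ j
    calc |ℓ j (X j x ω) (u j (X j x ω)) - ℓ j (X j y ω) (u j (X j y ω))|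
        ≤ Lℓ j * (‖X j x ω - X j y ω‖ + ‖u j (X j x ω) - u j (X j y ω)‖) := hℓ _ _ _ _ _
      _ ≤ Lℓ j * (‖X j x ω - X j y ω‖ + K * ‖X j x ω - X j y ω‖) := by
        gcongr
        exact hu _ _ _
      _ = Lℓ j * (1 + K) * ‖X j x ω - X j y ω‖ := by ring
      _ ≤ Lℓ j * (1 + K) * ((Lfx + Lfu * K) ^ j * ‖x - y‖) := by
        gcongr
        exact hX j ω
      _ = Lℓ j * (Lfx + Lfu * K) ^ j * (1 + K) * ‖x - y‖ := by ring
  rw [← integral_sub (integrable_finsetSum _ fun j _ => hInt j x)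
    (integrable_finsetSum _ fun j _ => hInt j y)]
  have hbound := norm_integral_le_of_norm_le_const (μ := μ)
    (f := fun ω => ∑ j ∈ Finset.range T, ℓ j (X j x ω) (u j (X j x ω)) -
      ∑ j ∈ Finset.range T, ℓ j (X j y ω) (u j (X j y ω)))
    (C := (∑ j ∈ Finset.range T, Lℓ j * (Lfx + Lfu * K) ^ j * (1 + K)) * ‖x - y‖)
    (Filter.Eventually.of_forall fun ω => by
      rw [← Finset.sum_sub_distrib, Finset.sum_mul]
      exact norm_sum_le_of_le _ fun j _ => hstage j ω)
  simpa using hbound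
end

section
/- Let T ≥ 1 be a natural number, c_R ≥ 0, c_δ > 0, δ_0 > 0, c₂ ≥ 0, and c₁ ∈ ℝ^{n_s} with c₁_i ≥ (2·T·c_R + c_δ)/δ_0 for all i. For j = 0, …, T−1 let ℓ_j, ℓ̃_j ∈ ℝ with |ℓ_j| ≤ c_R and |ℓ̃_j| ≤ c_R, and let ρ(j) ∈ ℝ^{n_s} with ρ(j)_i ≥ 0 for all i; set I(ρ) = c₁ᵀρ + c₂·ρᵀρ. If |Σ_{j=0}^{T−1} (ℓ_j − ℓ̃_j + I(ρ(j)))| < c_δ, then ρ(j)_i ≤ δ_0 for every j = 0, …, T−1 and every component i. -/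
/-- deterministic Lemma A.1: with penalty weights
`c₁_i ≥ (2Tc_R + c_δ)/δ₀`, bounded stage rewards and nonnegative slacks, if the total
penalized reward difference is `< c_δ` in absolute value, then every slack component
stays within the tightening margin `δ₀`. -/
theorem stmt_10 {ns : ℕ} (T : ℕ) (hT : 1 ≤ T)
    (cR cδ δ0 c₂ : ℝ) (hcR : 0 ≤ cR) (hcδ : 0 < cδ) (hδ0 : 0 < δ0) (hc₂ : 0 ≤ c₂)
    (c₁ : Fin ns → ℝ) (hc₁ : ∀ i, (2 * T * cR + cδ) / δ0 ≤ c₁ i)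
    (ℓ ℓt : ℕ → ℝ) (hℓ : ∀ j < T, |ℓ j| ≤ cR) (hℓt : ∀ j < T, |ℓt j| ≤ cR)
    (ρ : ℕ → Fin ns → ℝ) (hρ : ∀ j, ∀ i, 0 ≤ ρ j i)
    (hsmall :
      |∑ j ∈ Finset.range T,
          (ℓ j - ℓt j + ((∑ i, c₁ i * ρ j i) + c₂ * ∑ i, ρ j i * ρ j i))| < cδ) :
    ∀ j < T, ∀ i, ρ j i ≤ δ0 := by
  intro j hj i
  by_contra! hlt
  have hnum : 0 < 2 * T * cR + cδ := by positivity
  have hc₁_nonneg : ∀ k, 0 ≤ c₁ k := fun k => (div_pos hnum hδ0).le.trans (hc₁ k)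
  have hlinear : ∀ m, 0 ≤ ∑ k, c₁ k * ρ m k := fun m =>
    Finset.sum_nonneg fun k _ => mul_nonneg (hc₁_nonneg k) (hρ m k)
  have hquadratic : ∀ m, 0 ≤ c₂ * ∑ k, ρ m k * ρ m k := fun m =>
    mul_nonneg hc₂ (Finset.sum_nonneg fun k _ => mul_self_nonneg _)
  have hcomponent : 2 * T * cR + cδ ≤ c₁ i * ρ j i :=
    ((div_le_iff₀ hδ0).1 (hc₁ i)).trans (mul_le_mul_of_nonneg_left hlt.le (hc₁_nonneg i))
  have hstage : c₁ i * ρ j i ≤ ∑ k, c₁ k * ρ j k :=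
    Finset.single_le_sum (f := fun k => c₁ k * ρ j k)
      (fun k _ => mul_nonneg (hc₁_nonneg k) (hρ j k)) (Finset.mem_univ i)
  have hpenalty : (∑ k, c₁ k * ρ j k) + c₂ * ∑ k, ρ j k * ρ j k ≤
      ∑ m ∈ Finset.range T, ((∑ k, c₁ k * ρ m k) + c₂ * ∑ k, ρ m k * ρ m k) :=
    Finset.single_le_sum
      (f := fun m => (∑ k, c₁ k * ρ m k) + c₂ * ∑ k, ρ m k * ρ m k)
      (fun m _ => add_nonneg (hlinear m) (hquadratic m)) (Finset.mem_range.2 hj)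
  have hreward : -(2 * T * cR) ≤ ∑ m ∈ Finset.range T, (ℓ m - ℓt m) := by
    have hsum : ∑ _m ∈ Finset.range T, -(2 * cR) ≤ ∑ m ∈ Finset.range T, (ℓ m - ℓt m) :=
      Finset.sum_le_sum fun m hm => by
        have hm' := Finset.mem_range.1 hm
        linarith [(abs_le.1 (hℓ m hm')).1, (abs_le.1 (hℓt m hm')).2]
    rw [Finset.sum_const, Finset.card_range, nsmul_eq_mul] at hsum
    linarith
  rw [Finset.sum_add_distrib] at hsmall
  linarith [(abs_lt.1 hsmall).2, hquadratic j]
end
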